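/- Let σ ∈ M^{0,0}_{ρ,Λ} and let F : ℂ → ℂ be a C^∞ function (smooth as a function of two real variables). Then F ∘ σ ∈ M^{0,0}_{ρ,Λ}; that is, for all γ, δ ∈ {0,1}ⁿ the function x^δ ξ^γ (∂_x^δ ∂_ξ^γ (F ∘ σ))(x,ξ) belongs to S^{0,0}_{ρ,Λ}. -/

import Mathlib

open MeasureTheory Real Filter
open scoped RealInnerProductSpace BigOperators ENNReal

noncomputable section

/-- Euclidean space ℝⁿ. -/
abbrev En (n : ℕ) : Type := EuclideanSpace ℝ (Fin n)

/-- Partial derivative in the `i`-th coordinate direction. -/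
def pd {n : ℕ} {F : Type*} [NormedAddCommGroup F] [NormedSpace ℝ F]
    (i : Fin n) (f : En n → F) : En n → F :=
  fun x => fderiv ℝ f x (EuclideanSpace.single i 1)

/-- Iterated partial derivative `∂^α` for a multi-index `α`. -/
def mpd {n : ℕ} {F : Type*} [NormedAddCommGroup F] [NormedSpace ℝ F]
    (α : Fin n → ℕ) (f : En n → F) : En n → F :=
  (List.finRange n).foldr (fun i g => (pd i)^[α i] g) f

/-- Mixed derivative `∂_x^α ∂_ξ^β σ` of a symbol. -/
def mixpd {n : ℕ} (α β : Fin n → ℕ) (σ : En n → En n → ℂ) : En n → En n → ℂ :=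
  fun x ξ => mpd α (fun y => mpd β (σ y) ξ) x

/-- `Λ` is a weight function of polynomial growth with parameters `μ₀ ≤ μ₁ ≤ μ`. -/
structure IsWeight (n : ℕ) (Λ : En n → ℝ) (μ₀ μ₁ μ : ℝ) : Prop where
  pos : ∀ ξ, 0 < Λ ξ
  smooth : ContDiff ℝ (⊤ : ℕ∞) Λ
  growth : ∃ C₀ C₁ : ℝ, 0 < C₀ ∧ C₀ ≤ C₁ ∧ ∀ ξ : En n,
    C₀ * (1 + ‖ξ‖) ^ μ₀ ≤ Λ ξ ∧ Λ ξ ≤ C₁ * (1 + ‖ξ‖) ^ μ₁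
  hμ₀ : 0 < μ₀
  hμ₀₁ : μ₀ ≤ μ₁
  hμ₁ : μ₁ ≤ μ
  deriv_bound : ∀ (α γ : Fin n → ℕ), (∀ i, γ i ≤ 1) →
    ∃ C > 0, ∀ ξ : En n,
      |(∏ i, ξ i ^ γ i) * mpd (α + γ) Λ ξ| ≤ C * Λ ξ ^ (1 - (∑ i, (α i : ℝ)) / μ)

/-- The symbol class `S^m_{ρ,Λ}`. -/
def SClass {n : ℕ} (Λ : En n → ℝ) (ρ m : ℝ) (σ : En n → En n → ℂ) : Prop :=
  ContDiff ℝ (⊤ : ℕ∞) (fun q : En n × En n => σ q.1 q.2) ∧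
  ∀ α β : Fin n → ℕ, ∃ C > 0, ∀ x ξ : En n,
    ‖mixpd α β σ x ξ‖ ≤ C * Λ ξ ^ (m - ρ * ∑ i, (β i : ℝ))

/-- The symbol class `M^m_{ρ,Λ}`. -/
def MClass {n : ℕ} (Λ : En n → ℝ) (ρ m : ℝ) (σ : En n → En n → ℂ) : Prop :=
  ∀ γ : Fin n → ℕ, (∀ i, γ i ≤ 1) →
    SClass Λ ρ m (fun x ξ => ((∏ i, ξ i ^ γ i : ℝ) : ℂ) * mixpd 0 γ σ x ξ)

/-- The Fourier transform `φ̂(ξ) = (2π)^{-n/2} ∫ e^{-ix·ξ} φ(x) dx`. -/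
def ft {n : ℕ} (φ : En n → ℂ) (ξ : En n) : ℂ :=
  (((2 * Real.pi) ^ (-(n : ℝ) / 2) : ℝ) : ℂ) *
    ∫ (x : En n), Complex.exp (-Complex.I * (⟪x, ξ⟫ : ℂ)) * φ x

/-- The pseudo-differential operator `T_σ`. -/
def pdo {n : ℕ} (σ : En n → En n → ℂ) (φ : En n → ℂ) (x : En n) : ℂ :=
  (((2 * Real.pi) ^ (-(n : ℝ) / 2) : ℝ) : ℂ) *
    ∫ (ξ : En n), Complex.exp (Complex.I * (⟪x, ξ⟫ : ℂ)) * σ x ξ * ft φ ξ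

end

noncomputable section

/-- The SG symbol class `S^{m₁,m₂}_{ρ,Λ}`. -/
def SGClass {n : ℕ} (Λ : En n → ℝ) (ρ m₁ m₂ : ℝ) (σ : En n → En n → ℂ) : Prop :=
  ContDiff ℝ (⊤ : ℕ∞) (fun q : En n × En n => σ q.1 q.2) ∧
  ∀ α β : Fin n → ℕ, ∃ C > 0, ∀ x ξ : En n,
    ‖mixpd α β σ x ξ‖ ≤
      C * Λ x ^ (m₂ - ρ * ∑ i, (α i : ℝ)) * Λ ξ ^ (m₁ - ρ * ∑ i, (β i : ℝ))

/-- The SG symbol class `M^{m₁,m₂}_{ρ,Λ}`. -/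
def SGMClass {n : ℕ} (Λ : En n → ℝ) (ρ m₁ m₂ : ℝ) (σ : En n → En n → ℂ) : Prop :=
  ∀ γ δ : Fin n → ℕ, (∀ i, γ i ≤ 1) → (∀ i, δ i ≤ 1) →
    SGClass Λ ρ m₁ m₂ (fun x ξ =>
      ((∏ i, x i ^ δ i : ℝ) : ℂ) * ((∏ i, ξ i ^ γ i : ℝ) : ℂ) * mixpd δ γ σ x ξ)

end

open scoped ContDiff

theorem exists_norm_mul_le {X : Type*} {u v : X → ℝ} {f g : X → ℂ}
    (hf : ∃ C, ∀ q, ‖f q‖ ≤ C * u q)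
    (hg : ∃ C, ∀ q, ‖g q‖ ≤ C * v q) : ∃ C, ∀ q, ‖(f * g) q‖ ≤ C * (u * v) q := by
  obtain ⟨C, hC⟩ := hf
  obtain ⟨D, hD⟩ := hg
  refine ⟨C * D, fun q => ?_⟩
  rw [Pi.mul_apply, norm_mul, Pi.mul_apply, mul_mul_mul_comm]
  exact mul_le_mul (hC q) (hD q) (norm_nonneg _) ((norm_nonneg _).trans (hC q))

theorem exists_norm_comp_le {X : Type*} {f : X → ℂ}
    (hf : ∃ C, ∀ q, ‖f q‖ ≤ C * (1 : X → ℝ) q) {F : ℂ → ℂ} (hF : Continuous F) :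
    ∃ C, ∀ q, ‖(F ∘ f) q‖ ≤ C * (1 : X → ℝ) q := by
  obtain ⟨C, hC⟩ := hf
  obtain ⟨D, hD⟩ :=
    (isCompact_closedBall (0 : ℂ) C).exists_bound_of_continuousOn hF.continuousOn
  exact ⟨D, fun q => by simpa using hD (f q) (by simpa using hC q)⟩

section DirectionalCalculus

variable {X ι : Type*} [NormedAddCommGroup X] [NormedSpace ℝ X]

/-- Derivative of `f` in the fixed direction `v`. -/
noncomputable def dirDeriv (v : X) (f : X → ℂ) : X → ℂ := fun q => fderiv ℝ f q v

/-- Iterated directional derivative along a list of directions; the head is applied last. -/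
noncomputable def listDeriv (e : ι → X) (J : List ι) (f : X → ℂ) : X → ℂ :=
  J.foldr (fun j g => dirDeriv (e j) g) f

/-- The Euler-type derivation `c ∂_v`, where `c` is a linear coordinate. -/
noncomputable def coordDeriv (c : X →L[ℝ] ℝ) (v : X) (f : X → ℂ) : X → ℂ :=
  fun q => (c q : ℂ) * dirDeriv v f q

/-- Iterated Euler-type derivations along a list; the head is applied last. -/
noncomputable def listCoordDeriv (c : ι → X →L[ℝ] ℝ) (e : ι → X) (J : List ι) (f : X → ℂ) :
    X → ℂ :=
  J.foldr (fun j g => coordDeriv (c j) (e j) g) f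

/-- Symbol estimates up to order `k`: each derivative in the direction `e j` gains a factor `w j`
over the bound `v`. -/
def SymbolBound (e : ι → X) (w : ι → X → ℝ) : ℕ → (X → ℝ) → (X → ℂ) → Prop
  | 0, v, f => ∃ C, ∀ q, ‖f q‖ ≤ C * v q
  | k + 1, v, f => (∃ C, ∀ q, ‖f q‖ ≤ C * v q) ∧
      ∀ j, SymbolBound e w k (v * w j) (dirDeriv (e j) f)

/-- Smooth functions satisfying the symbol estimates of order zero. -/
def IsSymbol (e : ι → X) (w : ι → X → ℝ) (f : X → ℂ) : Prop :=
  ContDiff ℝ ∞ f ∧ ∀ k, SymbolBound e w k 1 f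

/-- Functions that stay symbols after applying any sublist of the derivations listed in `L`. -/
def IsMultSymbol (c : ι → X →L[ℝ] ℝ) (e : ι → X) (w : ι → X → ℝ) : List ι → (X → ℂ) → Prop
  | [], f => IsSymbol e w f
  | j :: L, f => IsMultSymbol c e w L f ∧ IsMultSymbol c e w L (coordDeriv (c j) (e j) f)

theorem ContDiff.dirDeriv {f : X → ℂ} (hf : ContDiff ℝ ∞ f) (v : X) :
    ContDiff ℝ ∞ (dirDeriv v f) :=
  (hf.fderiv_right (m := ∞) (by simp)).clm_apply contDiff_const

theorem ContDiff.listDeriv {f : X → ℂ} (hf : ContDiff ℝ ∞ f) (e : ι → X) (J : List ι) :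
    ContDiff ℝ ∞ (listDeriv e J f) := by
  induction J with
  | nil => exact hf
  | cons j J ih => exact ih.dirDeriv (e j)

theorem dirDeriv_add {f g : X → ℂ} (hf : ContDiff ℝ ∞ f) (hg : ContDiff ℝ ∞ g) (v : X) :
    dirDeriv v (f + g) = dirDeriv v f + dirDeriv v g := by
  funext q
  simp [dirDeriv, fderiv_add (hf.differentiable (by simp) q) (hg.differentiable (by simp) q)]

theorem dirDeriv_mul {f g : X → ℂ} (hf : ContDiff ℝ ∞ f) (hg : ContDiff ℝ ∞ g) (v : X) :
    dirDeriv v (f * g) = dirDeriv v f * g + f * dirDeriv v g := by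
  funext q
  simp [dirDeriv, fderiv_mul (hf.differentiable (by simp) q) (hg.differentiable (by simp) q)]
  ring

theorem dirDeriv_clm_comp {f : X → ℂ} (hf : ContDiff ℝ ∞ f) (A : ℂ →L[ℝ] ℂ) (v : X) :
    dirDeriv v (A ∘ f) = A ∘ dirDeriv v f := by
  funext q
  have h := (A.hasFDerivAt.comp q (hf.differentiable (by simp) q).hasFDerivAt).fderiv
  simp [dirDeriv, h]

/-- The real part as a real-linear endomorphism of `ℂ`. -/
noncomputable def rePart : ℂ →L[ℝ] ℂ := Complex.ofRealCLM.comp Complex.reCLM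

/-- The imaginary part as a real-linear endomorphism of `ℂ`. -/
noncomputable def imPart : ℂ →L[ℝ] ℂ := Complex.ofRealCLM.comp Complex.imCLM

theorem clm_apply_eq_rePart_add_imPart (A : ℂ →L[ℝ] ℂ) (z : ℂ) :
    A z = A 1 * rePart z + A Complex.I * imPart z := by
  conv_lhs => rw [← Complex.re_add_im z]
  have h₁ : (z.re : ℂ) = z.re • (1 : ℂ) := by simp
  have h₂ : (z.im : ℂ) * Complex.I = z.im • Complex.I := by simp
  rw [h₁, h₂, map_add, map_smul, map_smul]
  simp [rePart, imPart, mul_comm]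

theorem dirDeriv_comp {F : ℂ → ℂ} (hF : ContDiff ℝ ∞ F) {f : X → ℂ} (hf : ContDiff ℝ ∞ f)
    (v : X) :
    dirDeriv v (F ∘ f) = (dirDeriv 1 F ∘ f) * (rePart ∘ dirDeriv v f) +
      (dirDeriv Complex.I F ∘ f) * (imPart ∘ dirDeriv v f) := by
  funext q
  have h := fderiv_comp q (hF.differentiable (by simp) (f q)) (hf.differentiable (by simp) q)
  simp only [dirDeriv, h, ContinuousLinearMap.comp_apply, Pi.add_apply, Pi.mul_apply,
    Function.comp_apply]
  exact clm_apply_eq_rePart_add_imPart _ _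

theorem coordDeriv_add {f g : X → ℂ} (hf : ContDiff ℝ ∞ f) (hg : ContDiff ℝ ∞ g)
    (c : X →L[ℝ] ℝ) (v : X) : coordDeriv c v (f + g) = coordDeriv c v f + coordDeriv c v g := by
  funext q
  simp only [coordDeriv, dirDeriv_add hf hg, Pi.add_apply]
  ring

theorem coordDeriv_mul {f g : X → ℂ} (hf : ContDiff ℝ ∞ f) (hg : ContDiff ℝ ∞ g)
    (c : X →L[ℝ] ℝ) (v : X) :
    coordDeriv c v (f * g) = coordDeriv c v f * g + f * coordDeriv c v g := by
  funext q
  simp only [coordDeriv, dirDeriv_mul hf hg, Pi.add_apply, Pi.mul_apply]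
  ring

theorem coordDeriv_clm_comp {f : X → ℂ} (hf : ContDiff ℝ ∞ f) (A : ℂ →L[ℝ] ℂ)
    (c : X →L[ℝ] ℝ) (v : X) : coordDeriv c v (A ∘ f) = A ∘ coordDeriv c v f := by
  funext q
  simp only [coordDeriv, dirDeriv_clm_comp hf A, Function.comp_apply, ← Complex.real_smul,
    map_smul]

theorem coordDeriv_comp {F : ℂ → ℂ} (hF : ContDiff ℝ ∞ F) {f : X → ℂ} (hf : ContDiff ℝ ∞ f)
    (c : X →L[ℝ] ℝ) (v : X) :
    coordDeriv c v (F ∘ f) = (dirDeriv 1 F ∘ f) * (rePart ∘ coordDeriv c v f) +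
      (dirDeriv Complex.I F ∘ f) * (imPart ∘ coordDeriv c v f) := by
  funext q
  simp only [coordDeriv, dirDeriv_comp hF hf, Function.comp_apply, ← Complex.real_smul,
    map_smul, Pi.add_apply, Pi.mul_apply]
  simp only [Complex.real_smul]
  ring

theorem dirDeriv_comm {f : X → ℂ} (hf : ContDiff ℝ ∞ f) (u v : X) :
    dirDeriv u (dirDeriv v f) = dirDeriv v (dirDeriv u f) := by
  funext q
  have hd : DifferentiableAt ℝ (fderiv ℝ f) q :=
    (hf.fderiv_right (m := ∞) (by simp)).differentiable (by simp) q
  have key : ∀ a b : X, dirDeriv a (dirDeriv b f) q = fderiv ℝ (fderiv ℝ f) q a b := by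
    intro a b
    change fderiv ℝ (fun y => fderiv ℝ f y b) q a = _
    rw [fderiv_clm_apply hd (differentiableAt_const b)]
    simp
  rw [key, key]
  exact (hf.contDiffAt.isSymmSndFDerivAt
    (by simp only [minSmoothness_of_isRCLikeNormedField]; exact WithTop.coe_le_coe.2 le_top)).eq u v

theorem listDeriv_perm {f : X → ℂ} (hf : ContDiff ℝ ∞ f) (e : ι → X) {J K : List ι}
    (h : J.Perm K) : listDeriv e J f = listDeriv e K f := by
  induction h with
  | nil => rfl
  | cons j _ ih => exact congrArg (dirDeriv (e j)) ih
  | swap i j J => exact dirDeriv_comm (hf.listDeriv e J) _ _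
  | trans _ _ ih₁ ih₂ => exact ih₁.trans ih₂

theorem dirDeriv_ofReal_clm_mul {f : X → ℂ} (hf : ContDiff ℝ ∞ f) (c : X →L[ℝ] ℝ) {v : X}
    (hc : c v = 0) :
    dirDeriv v (fun q => (c q : ℂ) * f q) = fun q => (c q : ℂ) * dirDeriv v f q := by
  have hs : ContDiff ℝ ∞ (fun q => (c q : ℂ)) := Complex.ofRealCLM.contDiff.comp c.contDiff
  have h := dirDeriv_mul hs hf v
  have h0 : dirDeriv v (fun q => (c q : ℂ)) = 0 := by
    funext q
    have := (Complex.ofRealCLM.comp c).fderiv (x := q)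
    change fderiv ℝ (Complex.ofRealCLM.comp c) q v = 0
    rw [this]
    simp [hc]
  rw [h0, zero_mul, zero_add] at h
  exact h

theorem dirDeriv_coord_prod_mul {f : X → ℂ} (hf : ContDiff ℝ ∞ f) (c : ι → X →L[ℝ] ℝ) {v : X}
    (J : List ι) (hc : ∀ i ∈ J, c i v = 0) :
    ContDiff ℝ ∞ (fun q => (J.map fun i => (c i q : ℂ)).prod * f q) ∧
    dirDeriv v (fun q => (J.map fun i => (c i q : ℂ)).prod * f q) =
      fun q => (J.map fun i => (c i q : ℂ)).prod * dirDeriv v f q := by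
  induction J with
  | nil => simpa using hf
  | cons j J ih =>
    obtain ⟨hs, hd⟩ := ih fun i hi => hc i (List.mem_cons_of_mem _ hi)
    simp only [List.map_cons, List.prod_cons, mul_assoc]
    refine ⟨(Complex.ofRealCLM.contDiff.comp (c j).contDiff).mul hs, ?_⟩
    rw [dirDeriv_ofReal_clm_mul hs (c j) (hc j List.mem_cons_self), hd]

theorem listCoordDeriv_eq {f : X → ℂ} (hf : ContDiff ℝ ∞ f) {c : ι → X →L[ℝ] ℝ} {e : ι → X}
    (hce : ∀ i j, i ≠ j → c i (e j) = 0) {J : List ι} (hJ : J.Nodup) :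
    listCoordDeriv c e J f =
      fun q => (J.map fun i => (c i q : ℂ)).prod * listDeriv e J f q := by
  induction J with
  | nil => funext q; simp [listCoordDeriv, listDeriv]
  | cons j J ih =>
    rw [List.nodup_cons] at hJ
    have h := (dirDeriv_coord_prod_mul (hf.listDeriv e J) c (v := e j) J
      fun i hi => hce i j fun hij => hJ.1 (hij ▸ hi)).2
    funext q
    change (c j q : ℂ) * dirDeriv (e j) (listCoordDeriv c e J f) q = _
    rw [ih hJ.2, h]
    simp only [List.map_cons, List.prod_cons, mul_assoc]
    rfl

section SymbolAlgebra

variable {e : ι → X} {w : ι → X → ℝ} {c : ι → X →L[ℝ] ℝ}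

theorem SymbolBound.pred {k : ℕ} {v : X → ℝ} {f : X → ℂ} (h : SymbolBound e w (k + 1) v f) :
    SymbolBound e w k v f := by
  induction k generalizing v f with
  | zero => exact h.1
  | succ k ih => exact ⟨h.1, fun j => ih (h.2 j)⟩

theorem SymbolBound.add {k : ℕ} {v : X → ℝ} {f g : X → ℂ} (sf : ContDiff ℝ ∞ f)
    (sg : ContDiff ℝ ∞ g) (hf : SymbolBound e w k v f) (hg : SymbolBound e w k v g) :
    SymbolBound e w k v (f + g) := by
  induction k generalizing v f g with
  | zero =>
    obtain ⟨C, hC⟩ := hf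
    obtain ⟨D, hD⟩ := hg
    exact ⟨C + D, fun q => (norm_add_le _ _).trans (by linarith [hC q, hD q])⟩
  | succ k ih =>
    obtain ⟨C, hC⟩ := hf.1
    obtain ⟨D, hD⟩ := hg.1
    refine ⟨⟨C + D, fun q => (norm_add_le _ _).trans (by linarith [hC q, hD q])⟩, fun j => ?_⟩
    rw [dirDeriv_add sf sg]
    exact ih (sf.dirDeriv _) (sg.dirDeriv _) (hf.2 j) (hg.2 j)

theorem SymbolBound.mul {k : ℕ} {u v : X → ℝ} {f g : X → ℂ} (sf : ContDiff ℝ ∞ f)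
    (sg : ContDiff ℝ ∞ g) (hf : SymbolBound e w k u f) (hg : SymbolBound e w k v g) :
    SymbolBound e w k (u * v) (f * g) := by
  induction k generalizing u v f g with
  | zero => exact exists_norm_mul_le hf hg
  | succ k ih =>
    refine ⟨exists_norm_mul_le hf.1 hg.1, fun j => ?_⟩
    rw [dirDeriv_mul sf sg]
    refine SymbolBound.add ((sf.dirDeriv _).mul sg) (sf.mul (sg.dirDeriv _)) ?_ ?_
    · rw [mul_right_comm]
      exact ih (sf.dirDeriv _) sg (hf.2 j) hg.pred
    · rw [mul_assoc]
      exact ih sf (sg.dirDeriv _) hf.pred (hg.2 j)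

theorem SymbolBound.clm_comp {k : ℕ} {v : X → ℝ} {f : X → ℂ} (sf : ContDiff ℝ ∞ f)
    (hf : SymbolBound e w k v f) (A : ℂ →L[ℝ] ℂ) : SymbolBound e w k v (A ∘ f) := by
  have base : ∀ {v : X → ℝ} {f : X → ℂ}, (∃ C, ∀ q, ‖f q‖ ≤ C * v q) →
      ∃ C, ∀ q, ‖(A ∘ f) q‖ ≤ C * v q := by
    rintro v f ⟨C, hC⟩
    refine ⟨‖A‖ * C, fun q => (A.le_opNorm _).trans ?_⟩
    rw [mul_assoc]
    exact mul_le_mul_of_nonneg_left (hC q) (norm_nonneg _)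
  induction k generalizing v f with
  | zero => exact base hf
  | succ k ih =>
    refine ⟨base hf.1, fun j => ?_⟩
    rw [dirDeriv_clm_comp sf]
    exact ih (sf.dirDeriv _) (hf.2 j)

theorem SymbolBound.comp {k : ℕ} {f : X → ℂ} (sf : ContDiff ℝ ∞ f)
    (hf : SymbolBound e w k 1 f) {F : ℂ → ℂ} (hF : ContDiff ℝ ∞ F) :
    SymbolBound e w k 1 (F ∘ f) := by
  induction k generalizing F with
  | zero => exact exists_norm_comp_le hf hF.continuous
  | succ k ih =>
    refine ⟨exists_norm_comp_le hf.1 hF.continuous, fun j => ?_⟩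
    have sD := sf.dirDeriv (e j)
    have hcomp : ∀ z : ℂ, SymbolBound e w k 1 (dirDeriv z F ∘ f) :=
      fun z => ih hf.pred (hF.dirDeriv z)
    rw [dirDeriv_comp hF sf, ← one_mul (1 * w j)]
    exact SymbolBound.add
      (((hF.dirDeriv _).comp sf).mul (rePart.contDiff.comp sD))
      (((hF.dirDeriv _).comp sf).mul (imPart.contDiff.comp sD))
      ((hcomp 1).mul ((hF.dirDeriv _).comp sf) (rePart.contDiff.comp sD)
        ((hf.2 j).clm_comp sD _))
      ((hcomp Complex.I).mul ((hF.dirDeriv _).comp sf) (imPart.contDiff.comp sD)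
        ((hf.2 j).clm_comp sD _))

theorem symbolBound_iff_listDeriv {k : ℕ} {v : X → ℝ} {f : X → ℂ} :
    SymbolBound e w k v f ↔ ∀ J : List ι, J.length ≤ k →
      ∃ C, ∀ q, ‖listDeriv e J.reverse f q‖ ≤ C * (v q * (J.map fun j => w j q).prod) := by
  induction k generalizing v f with
  | zero =>
    refine ⟨fun h J hJ => ?_, fun h => ?_⟩
    · obtain rfl : J = [] := List.length_eq_zero_iff.1 (Nat.le_zero.1 hJ)
      simpa [listDeriv, SymbolBound] using h
    · simpa [listDeriv, SymbolBound] using h [] le_rfl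
  | succ k ih =>
    have step : ∀ (j : ι) (J : List ι),
        listDeriv e (j :: J).reverse f = listDeriv e J.reverse (dirDeriv (e j) f) := by
      intro j J
      simp [listDeriv]
    refine ⟨fun h J hJ => ?_, fun h => ⟨?_, fun j => ih.2 fun J hJ => ?_⟩⟩
    · cases J with
      | nil => simpa [listDeriv] using h.1
      | cons j J =>
        obtain ⟨C, hC⟩ := ih.1 (h.2 j) J (by simpa using hJ)
        refine ⟨C, fun q => ?_⟩
        rw [step, List.map_cons, List.prod_cons, ← mul_assoc (v q)]
        exact hC q
    · simpa [listDeriv] using h [] (Nat.zero_le _)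
    · obtain ⟨C, hC⟩ := h (j :: J) (by simpa using hJ)
      refine ⟨C, fun q => ?_⟩
      have := hC q
      rw [step, List.map_cons, List.prod_cons, ← mul_assoc (v q)] at this
      exact this

theorem isSymbol_iff {f : X → ℂ} : IsSymbol e w f ↔ ContDiff ℝ ∞ f ∧
    ∀ J : List ι, ∃ C, ∀ q, ‖listDeriv e J f q‖ ≤ C * (J.map fun j => w j q).prod := by
  refine and_congr_right fun _ => ⟨fun h J => ?_, fun h k => ?_⟩
  · obtain ⟨C, hC⟩ := symbolBound_iff_listDeriv.1 (h J.reverse.length) J.reverse le_rfl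
    exact ⟨C, fun q => by simpa [List.prod_reverse] using hC q⟩
  · refine symbolBound_iff_listDeriv.2 fun J _ => ?_
    obtain ⟨C, hC⟩ := h J.reverse
    exact ⟨C, fun q => by simpa [List.prod_reverse] using hC q⟩

theorem IsMultSymbol.contDiff {L : List ι} {f : X → ℂ} (h : IsMultSymbol c e w L f) :
    ContDiff ℝ ∞ f := by
  induction L with
  | nil => exact h.1
  | cons j L ih => exact ih h.1

theorem IsMultSymbol.add {L : List ι} {f g : X → ℂ} (hf : IsMultSymbol c e w L f)
    (hg : IsMultSymbol c e w L g) : IsMultSymbol c e w L (f + g) := by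
  induction L generalizing f g with
  | nil => exact ⟨hf.1.add hg.1, fun k => (hf.2 k).add hf.1 hg.1 (hg.2 k)⟩
  | cons j L ih =>
    refine ⟨ih hf.1 hg.1, ?_⟩
    rw [coordDeriv_add hf.contDiff hg.contDiff]
    exact ih hf.2 hg.2

theorem IsMultSymbol.mul {L : List ι} {f g : X → ℂ} (hf : IsMultSymbol c e w L f)
    (hg : IsMultSymbol c e w L g) : IsMultSymbol c e w L (f * g) := by
  induction L generalizing f g with
  | nil =>
    exact ⟨hf.1.mul hg.1, fun k => by simpa using (hf.2 k).mul hf.1 hg.1 (hg.2 k)⟩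
  | cons j L ih =>
    refine ⟨ih hf.1 hg.1, ?_⟩
    rw [coordDeriv_mul hf.contDiff hg.contDiff]
    exact (ih hf.2 hg.1).add (ih hf.1 hg.2)

theorem IsMultSymbol.clm_comp {L : List ι} {f : X → ℂ} (hf : IsMultSymbol c e w L f)
    (A : ℂ →L[ℝ] ℂ) : IsMultSymbol c e w L (A ∘ f) := by
  induction L generalizing f with
  | nil => exact ⟨A.contDiff.comp hf.1, fun k => (hf.2 k).clm_comp hf.1 A⟩
  | cons j L ih =>
    refine ⟨ih hf.1, ?_⟩
    rw [coordDeriv_clm_comp hf.contDiff]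
    exact ih hf.2

theorem IsMultSymbol.comp {L : List ι} {f : X → ℂ} (hf : IsMultSymbol c e w L f)
    {F : ℂ → ℂ} (hF : ContDiff ℝ ∞ F) : IsMultSymbol c e w L (F ∘ f) := by
  induction L generalizing F with
  | nil => exact ⟨hF.comp hf.1, fun k => (hf.2 k).comp hf.1 hF⟩
  | cons j L ih =>
    refine ⟨ih hf.1 hF, ?_⟩
    rw [coordDeriv_comp hF hf.contDiff]
    exact ((ih hf.1 (hF.dirDeriv _)).mul (hf.2.clm_comp _)).add
      ((ih hf.1 (hF.dirDeriv _)).mul (hf.2.clm_comp _))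

theorem isMultSymbol_iff {L : List ι} {f : X → ℂ} : IsMultSymbol c e w L f ↔
    ∀ K : List ι, K.Sublist L → IsSymbol e w (listCoordDeriv c e K.reverse f) := by
  induction L generalizing f with
  | nil =>
    refine ⟨fun h K hK => ?_, fun h => h [] (List.Sublist.refl _)⟩
    obtain rfl := List.sublist_nil.1 hK
    exact h
  | cons j L ih =>
    have step : ∀ K : List ι, listCoordDeriv c e (j :: K).reverse f =
        listCoordDeriv c e K.reverse (coordDeriv (c j) (e j) f) := by
      intro K
      simp [listCoordDeriv]
    refine ⟨fun h K hK => ?_, fun h => ⟨ih.2 fun K hK => h K (hK.cons j), ih.2 fun K hK => ?_⟩⟩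
    · cases hK with
      | cons _ hK => exact ih.1 h.1 K hK
      | cons_cons _ hK =>
        rw [step]
        exact ih.1 h.2 _ hK
    · rw [← step]
      exact h _ (hK.cons_cons j)

/-- Composition with a smooth function preserves the condition that all derivations along
repetition-free lists of coordinates give symbols. -/
theorem isSymbol_listCoordDeriv_comp {f : X → ℂ}
    (hf : ∀ L : List ι, L.Nodup → IsSymbol e w (listCoordDeriv c e L f))
    {F : ℂ → ℂ} (hF : ContDiff ℝ ∞ F) {L : List ι} (hL : L.Nodup) :
    IsSymbol e w (listCoordDeriv c e L (F ∘ f)) := by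
  have h : IsMultSymbol c e w L.reverse f := isMultSymbol_iff.2 fun K hK =>
    hf _ (List.nodup_reverse.2 ((List.nodup_reverse.2 hL).sublist hK))
  simpa using isMultSymbol_iff.1 (h.comp hF) _ (List.Sublist.refl _)

end SymbolAlgebra

end DirectionalCalculus

section PhaseSpace

variable {n : ℕ}

/-- Standard basis of phase space: `Sum.inl` for positions, `Sum.inr` for frequencies. -/
noncomputable def phaseBasis (j : Fin n ⊕ Fin n) : En n × En n :=
  j.elim (fun i => (EuclideanSpace.single i 1, 0)) (fun i => (0, EuclideanSpace.single i 1))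

/-- Coordinates of phase space. -/
noncomputable def phaseCoord (j : Fin n ⊕ Fin n) : En n × En n →L[ℝ] ℝ :=
  j.elim (fun i => (EuclideanSpace.proj i).comp (ContinuousLinearMap.fst ℝ (En n) (En n)))
    (fun i => (EuclideanSpace.proj i).comp (ContinuousLinearMap.snd ℝ (En n) (En n)))

/-- The decay gained by a derivative in each direction of phase space. -/
noncomputable def phaseWeight (Λ : En n → ℝ) (ρ : ℝ) (j : Fin n ⊕ Fin n) :
    En n × En n → ℝ :=
  j.elim (fun _ q => Λ q.1 ^ (-ρ)) (fun _ q => Λ q.2 ^ (-ρ))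

/-- The sorted list in which `i` occurs `α i` times. -/
def expandIndex (α : Fin n → ℕ) : List (Fin n) :=
  (List.finRange n).flatMap fun i => List.replicate (α i) i

/-- The list of phase space directions of the multi-index `(α, β)`. -/
def phaseIndex (α β : Fin n → ℕ) : List (Fin n ⊕ Fin n) :=
  (expandIndex α).map Sum.inl ++ (expandIndex β).map Sum.inr

theorem phaseCoord_phaseBasis (i j : Fin n ⊕ Fin n) (h : i ≠ j) :
    phaseCoord i (phaseBasis j) = 0 := by
  rcases i with i | i <;> rcases j with j | j <;>
    simp_all [phaseCoord, phaseBasis]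

theorem count_expandIndex (α : Fin n → ℕ) (i : Fin n) : (expandIndex α).count i = α i := by
  rw [expandIndex, List.count_flatMap, ← Fin.sum_univ_def]
  simp [List.count_replicate]

theorem length_expandIndex (α : Fin n → ℕ) : (expandIndex α).length = ∑ i, α i := by
  rw [expandIndex, List.length_flatMap, ← Fin.sum_univ_def]
  simp

theorem prod_map_expandIndex {M : Type*} [CommMonoid M] (α : Fin n → ℕ) (g : Fin n → M) :
    ((expandIndex α).map g).prod = ∏ i, g i ^ α i := by
  rw [Fin.prod_univ_def, expandIndex]
  induction List.finRange n with
  | nil => simp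
  | cons a l ih => simp [ih]

instance : LawfulBEq (Fin n ⊕ Fin n) where
  eq_of_beq {a b} h := by
    rcases a with a | a <;> rcases b with b | b
    · exact congrArg Sum.inl (eq_of_beq (a := a) (b := b) h)
    · exact Bool.noConfusion h
    · exact Bool.noConfusion h
    · exact congrArg Sum.inr (eq_of_beq (a := a) (b := b) h)
  rfl {a} := by
    rcases a with a | a
    · exact beq_self_eq_true a
    · exact beq_self_eq_true a

theorem phaseIndex_perm (J : List (Fin n ⊕ Fin n)) :
    (phaseIndex (fun i => J.count (Sum.inl i)) fun i => J.count (Sum.inr i)).Perm J := by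
  rw [List.perm_iff_count]
  rintro (i | i)
  · have h : ∀ K : List (Fin n), (K.map Sum.inr).count (Sum.inl i : Fin n ⊕ Fin n) = 0 :=
      fun K => List.count_eq_zero_of_not_mem (by simp)
    rw [phaseIndex, List.count_append, List.count_map_of_injective _ _ Sum.inl_injective,
      count_expandIndex, h, add_zero]
  · have h : ∀ K : List (Fin n), (K.map Sum.inl).count (Sum.inr i : Fin n ⊕ Fin n) = 0 :=
      fun K => List.count_eq_zero_of_not_mem (by simp)
    rw [phaseIndex, List.count_append, List.count_map_of_injective _ _ Sum.inr_injective,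
      count_expandIndex, h, zero_add]

theorem nodup_phaseIndex {α β : Fin n → ℕ} (hα : ∀ i, α i ≤ 1) (hβ : ∀ i, β i ≤ 1) :
    (phaseIndex α β).Nodup := by
  refine List.Nodup.append ?_ ?_ ?_
  · refine List.Nodup.map Sum.inl_injective (List.nodup_iff_count_le_one.2 fun i => ?_)
    rw [count_expandIndex]
    exact hα i
  · refine List.Nodup.map Sum.inr_injective (List.nodup_iff_count_le_one.2 fun i => ?_)
    rw [count_expandIndex]
    exact hβ i
  · intro a ha hb
    simp only [List.mem_map] at ha hb
    obtain ⟨i, _, rfl⟩ := ha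
    obtain ⟨j, _, h⟩ := hb
    exact Sum.inr_ne_inl h

theorem mpd_eq_foldr (α : Fin n → ℕ) (f : En n → ℂ) :
    mpd α f = (expandIndex α).foldr (fun i g => pd i g) f := by
  rw [mpd, expandIndex]
  induction List.finRange n with
  | nil => rfl
  | cons a l ih =>
    rw [List.foldr_cons, ih, List.flatMap_cons, List.foldr_append]
    generalize List.foldr (fun i g => pd i g) f _ = h
    induction α a with
    | zero => rfl
    | succ k ihk => rw [Function.iterate_succ_apply', ihk, List.replicate_succ, List.foldr_cons]

theorem foldr_pd_fst {g : En n × En n → ℂ} (hg : ContDiff ℝ ∞ g) (J : List (Fin n)) (ξ : En n) :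
    J.foldr (fun i g => pd i g) (fun y => g (y, ξ)) =
      fun x => listDeriv phaseBasis (J.map Sum.inl) g (x, ξ) := by
  induction J with
  | nil => rfl
  | cons j J ih =>
    funext x
    rw [List.foldr_cons, ih]
    have hd : HasFDerivAt (listDeriv phaseBasis (J.map Sum.inl) g) _ (x, ξ) :=
      ((hg.listDeriv _ _).differentiable (by simp) (x, ξ)).hasFDerivAt
    have h := (hd.comp x (hasFDerivAt_prodMk_left (𝕜 := ℝ) x ξ)).fderiv
    change fderiv ℝ (listDeriv phaseBasis (J.map Sum.inl) g ∘ fun y => (y, ξ)) x _ = _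
    rw [h]
    simp [listDeriv, dirDeriv, phaseBasis]

theorem foldr_pd_snd {g : En n × En n → ℂ} (hg : ContDiff ℝ ∞ g) (J : List (Fin n)) (x : En n) :
    J.foldr (fun i g => pd i g) (fun η => g (x, η)) =
      fun ξ => listDeriv phaseBasis (J.map Sum.inr) g (x, ξ) := by
  induction J with
  | nil => rfl
  | cons j J ih =>
    funext ξ
    rw [List.foldr_cons, ih]
    have hd : HasFDerivAt (listDeriv phaseBasis (J.map Sum.inr) g) _ (x, ξ) :=
      ((hg.listDeriv _ _).differentiable (by simp) (x, ξ)).hasFDerivAt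
    have h := (hd.comp ξ (hasFDerivAt_prodMk_right (𝕜 := ℝ) x ξ)).fderiv
    change fderiv ℝ (listDeriv phaseBasis (J.map Sum.inr) g ∘ fun η => (x, η)) ξ _ = _
    rw [h]
    simp [listDeriv, dirDeriv, phaseBasis]

theorem mixpd_eq_listDeriv {σ : En n → En n → ℂ}
    (hσ : ContDiff ℝ ∞ (fun q : En n × En n => σ q.1 q.2)) (α β : Fin n → ℕ) (x ξ : En n) :
    mixpd α β σ x ξ =
      listDeriv phaseBasis (phaseIndex α β) (fun q : En n × En n => σ q.1 q.2) (x, ξ) := by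
  have h : ∀ y, mpd β (σ y) ξ = listDeriv phaseBasis ((expandIndex β).map Sum.inr)
      (fun q : En n × En n => σ q.1 q.2) (y, ξ) := by
    intro y
    rw [mpd_eq_foldr]
    exact congrFun (foldr_pd_snd hσ (expandIndex β) y) ξ
  simp only [mixpd, h, mpd_eq_foldr]
  rw [foldr_pd_fst (hσ.listDeriv _ _)]
  simp [phaseIndex, listDeriv]

theorem prod_map_phaseWeight {Λ : En n → ℝ} (hΛ : ∀ x, 0 < Λ x) (ρ : ℝ) (α β : Fin n → ℕ)
    (q : En n × En n) : ((phaseIndex α β).map fun j => phaseWeight Λ ρ j q).prod =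
      Λ q.1 ^ (0 - ρ * ∑ i, (α i : ℝ)) * Λ q.2 ^ (0 - ρ * ∑ i, (β i : ℝ)) := by
  have key : ∀ (y : En n) (α : Fin n → ℕ),
      (Λ y ^ (-ρ)) ^ (expandIndex α).length = Λ y ^ (0 - ρ * ∑ i, (α i : ℝ)) := by
    intro y α
    rw [← Real.rpow_natCast, ← Real.rpow_mul (hΛ y).le, length_expandIndex]
    push_cast
    ring_nf
  rw [← key, ← key]
  simp [phaseIndex, phaseWeight, Function.comp_def]

theorem prod_map_phaseCoord (α β : Fin n → ℕ) (q : En n × En n) :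
    ((phaseIndex α β).map fun j => (phaseCoord j q : ℂ)).prod =
      ((∏ i, q.1 i ^ α i : ℝ) : ℂ) * ((∏ i, q.2 i ^ β i : ℝ) : ℂ) := by
  rw [phaseIndex, List.map_append, List.prod_append, List.map_map, List.map_map,
    prod_map_expandIndex, prod_map_expandIndex]
  simp [phaseCoord]

theorem SGClass_zero_iff {Λ : En n → ℝ} (hΛ : ∀ x, 0 < Λ x) {ρ : ℝ} {σ : En n → En n → ℂ} :
    SGClass Λ ρ 0 0 σ ↔
      IsSymbol phaseBasis (phaseWeight Λ ρ) (fun q : En n × En n => σ q.1 q.2) := by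
  rw [isSymbol_iff, SGClass]
  refine and_congr_right fun hs => ⟨fun h J => ?_, fun h α β => ?_⟩
  · obtain ⟨C, -, hC⟩ := h (fun i => J.count (Sum.inl i)) fun i => J.count (Sum.inr i)
    refine ⟨C, fun q => ?_⟩
    rw [← listDeriv_perm hs phaseBasis (phaseIndex_perm J),
      ← ((phaseIndex_perm J).map _).prod_eq, prod_map_phaseWeight hΛ, ← mul_assoc]
    have := hC q.1 q.2
    rwa [mixpd_eq_listDeriv hs] at this
  · obtain ⟨C, hC⟩ := h (phaseIndex α β)
    refine ⟨max C 1, by positivity, fun x ξ => ?_⟩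
    rw [mixpd_eq_listDeriv hs, mul_assoc]
    refine (hC (x, ξ)).trans ?_
    rw [prod_map_phaseWeight hΛ]
    exact mul_le_mul_of_nonneg_right (le_max_left _ _)
      (mul_nonneg (Real.rpow_nonneg (hΛ _).le _) (Real.rpow_nonneg (hΛ _).le _))

theorem mul_mixpd_eq_listCoordDeriv {σ : En n → En n → ℂ}
    (hσ : ContDiff ℝ ∞ (fun q : En n × En n => σ q.1 q.2)) {J : List (Fin n ⊕ Fin n)}
    (hJ : J.Nodup) {δ γ : Fin n → ℕ} (h : (phaseIndex δ γ).Perm J) :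
    (fun q : En n × En n => ((∏ i, q.1 i ^ δ i : ℝ) : ℂ) * ((∏ i, q.2 i ^ γ i : ℝ) : ℂ) *
      mixpd δ γ σ q.1 q.2) =
      listCoordDeriv phaseCoord phaseBasis J (fun q : En n × En n => σ q.1 q.2) := by
  rw [listCoordDeriv_eq hσ phaseCoord_phaseBasis hJ]
  funext q
  rw [← prod_map_phaseCoord, (h.map _).prod_eq, mixpd_eq_listDeriv hσ, listDeriv_perm hσ _ h]

theorem SGMClass_zero_iff {Λ : En n → ℝ} (hΛ : ∀ x, 0 < Λ x) {ρ : ℝ} {σ : En n → En n → ℂ}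
    (hσ : ContDiff ℝ ∞ (fun q : En n × En n => σ q.1 q.2)) :
    SGMClass Λ ρ 0 0 σ ↔ ∀ J : List (Fin n ⊕ Fin n), J.Nodup →
      IsSymbol phaseBasis (phaseWeight Λ ρ)
        (listCoordDeriv phaseCoord phaseBasis J (fun q : En n × En n => σ q.1 q.2)) := by
  refine ⟨fun h J hJ => ?_, fun h γ δ hγ hδ => ?_⟩
  · rw [← mul_mixpd_eq_listCoordDeriv hσ hJ (phaseIndex_perm J)]
    exact (SGClass_zero_iff hΛ).1 (h _ _ (fun i => List.nodup_iff_count_le_one.1 hJ _)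
      fun i => List.nodup_iff_count_le_one.1 hJ _)
  · rw [SGClass_zero_iff hΛ]
    have hJ := nodup_phaseIndex hδ hγ
    rw [mul_mixpd_eq_listCoordDeriv hσ hJ (List.Perm.refl _)]
    exact h _ hJ

theorem mpd_zero (f : En n → ℂ) : mpd 0 f = f := by
  rw [mpd]
  induction List.finRange n with
  | nil => rfl
  | cons a l ih => rw [List.foldr_cons, ih]; rfl

theorem SGMClass.contDiff {Λ : En n → ℝ} {ρ m₁ m₂ : ℝ} {σ : En n → En n → ℂ}
    (h : SGMClass Λ ρ m₁ m₂ σ) : ContDiff ℝ ∞ (fun q : En n × En n => σ q.1 q.2) := by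
  simpa [mixpd, mpd_zero] using (h 0 0 (by simp) (by simp)).1

end PhaseSpace

/-- if `σ ∈ M^{0,0}_{ρ,Λ}` and `F : ℂ → ℂ` is smooth, then
`F ∘ σ ∈ M^{0,0}_{ρ,Λ}`. -/
theorem comp_SGMClass_zero (n : ℕ) (hn : 1 ≤ n) (Λ : En n → ℝ) (μ₀ μ₁ μ ρ : ℝ)
    (hw : IsWeight n Λ μ₀ μ₁ μ) (hρ : 0 < ρ) (hρμ : ρ ≤ 1 / μ)
    (σ : En n → En n → ℂ) (hσ : SGMClass Λ ρ 0 0 σ)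
    (F : ℂ → ℂ) (hF : ContDiff ℝ (⊤ : ℕ∞) F) :
    SGMClass Λ ρ 0 0 (fun x ξ => F (σ x ξ)) := by
  rw [SGMClass_zero_iff hw.pos (hF.comp hσ.contDiff)]
  exact fun J hJ =>
    isSymbol_listCoordDeriv_comp ((SGMClass_zero_iff hw.pos hσ.contDiff).1 hσ) hF hJ
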